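/- Let K be a field and X a locally finite poset. There exists an involution on the K-algebra D(X,K) if and only if there exists an involution on the poset X. -/

import Mathlib

namespace IncidenceAlgebra

open Finset TrivSqZeroExt

variable {K X : Type*} [Field K] [PartialOrder X]

section Single

variable [DecidableEq X]

/-- The diagonal idempotent of the incidence algebra supported at `(x, x)`. -/
def single (K : Type*) {X : Type*} [Field K] [PartialOrder X] [DecidableEq X] (x : X) :
    IncidenceAlgebra K X :=
  ⟨fun a b ↦ if a = x ∧ b = x then 1 else 0, fun _ _ h ↦ if_neg fun ⟨ha, hb⟩ ↦
    h (ha.trans hb.symm).le⟩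

lemma single_apply (x a b : X) : single K x a b = if a = x ∧ b = x then 1 else 0 := rfl

variable [LocallyFiniteOrder X]

lemma single_mul_apply (x : X) (f : IncidenceAlgebra K X) (a b : X) :
    (single K x * f) a b = if a = x then f x b else 0 := by
  rw [mul_apply]
  split_ifs with h
  · subst h
    by_cases hab : a ≤ b
    · rw [Finset.sum_eq_single a]
      · simp [single_apply]
      · intro c _ hc
        simp [single_apply, hc]
      · simp [hab]
    · rw [Finset.Icc_eq_empty hab, apply_eq_zero_of_not_le hab]
      simp
  · exact Finset.sum_eq_zero fun c _ ↦ by simp [single_apply, h]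

lemma mul_single_apply (x : X) (f : IncidenceAlgebra K X) (a b : X) :
    (f * single K x) a b = if b = x then f a x else 0 := by
  rw [mul_apply]
  split_ifs with h
  · subst h
    by_cases hab : a ≤ b
    · rw [Finset.sum_eq_single b]
      · simp [single_apply]
      · intro c _ hc
        simp [single_apply, hc]
      · simp [hab]
    · rw [Finset.Icc_eq_empty hab, apply_eq_zero_of_not_le hab]
      simp
  · exact Finset.sum_eq_zero fun c _ ↦ by simp [single_apply, h]

lemma single_mul_mul_single (x : X) (f : IncidenceAlgebra K X) :
    single K x * f * single K x = f x x • single K x := by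
  ext a b _
  rw [mul_single_apply, single_mul_apply, constSMul_apply, single_apply]
  split_ifs <;> simp_all

lemma single_mul_mul_single_eq_zero {x y : X} (h : ¬x ≤ y) (f : IncidenceAlgebra K X) :
    single K x * f * single K y = 0 := by
  ext a b _
  rw [mul_single_apply, single_mul_apply, apply_eq_zero_of_not_le h, zero_apply]
  simp

lemma single_mul_single_of_ne {x y : X} (h : x ≠ y) : single K x * single K y = 0 := by
  ext a b _
  rw [single_mul_apply, single_apply, zero_apply]
  simp [h]

lemma single_mul_self (x : X) : single K x * single K x = single K x := by
  ext a b _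
  rw [single_mul_apply, single_apply, single_apply]
  simp [ite_and]

end Single

lemma mul_apply_self [LocallyFiniteOrder X] (f g : IncidenceAlgebra K X) (x : X) :
    (f * g) x x = f x x * g x x := by
  simp

lemma eq_zero_of_mul_self_of_diag [LocallyFiniteOrder X] {f : IncidenceAlgebra K X}
    (hf : f * f = f) (hd : ∀ x, f x x = 0) : f = 0 := by
  have key : ∀ (n : ℕ) (a b : X), (Icc a b).card = n → f a b = 0 := by
    intro n
    induction n using Nat.strong_induction_on with
    | _ n ih =>
      intro a b hn
      rw [← hf, mul_apply]
      refine Finset.sum_eq_zero fun z hz ↦ ?_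
      obtain ⟨haz, hzb⟩ := Finset.mem_Icc.1 hz
      rcases hzb.eq_or_lt with rfl | hlt
      · rw [hd, mul_zero]
      · rw [ih _ (hn ▸ Finset.card_lt_card ?_) a z rfl, zero_mul]
        exact Finset.Icc_ssubset_Icc_right (haz.trans hzb) le_rfl hlt
  ext a b _
  exact key _ a b rfl

section Idealization

variable [LocallyFiniteOrder X] [DecidableEq X]

/-- The idealization `I(X, K)(+)I(X, K)`. -/
local notation "𝓓" => TrivSqZeroExt (IncidenceAlgebra K X) (IncidenceAlgebra K X)

lemma fst_pow_apply_self (u : 𝓓) (x : X) (n : ℕ) : (u ^ n).fst x x = u.fst x x ^ n := by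
  induction n with
  | zero => simp
  | succ n ih => rw [pow_succ, fst_mul, mul_apply_self, ih, pow_succ]

lemma isNilpotent_inl_single_mul_iff (u : 𝓓) (x : X) :
    IsNilpotent (inl (single K x) * u) ↔ u.fst x x = 0 := by
  constructor
  · rintro ⟨n, hn⟩
    have h := congrArg (fun v : 𝓓 ↦ v.fst x x) hn
    simp only [fst_pow_apply_self, fst_mul, fst_inl, fst_zero, zero_apply, single_mul_apply,
      if_true] at h
    simpa using eq_zero_of_pow_eq_zero h
  · intro h
    set w : 𝓓 := inl (single K x) * u with hw
    have hfst : (w * w).fst = 0 := by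
      rw [fst_mul, hw, fst_mul, fst_inl, ← mul_assoc, single_mul_mul_single, h, zero_smul,
        zero_mul]
    refine ⟨4, ?_⟩
    have h4 : w ^ 4 = (w * w) * (w * w) := by
      rw [← pow_two, ← pow_two, ← pow_mul]
    rw [h4]
    ext1
    · rw [fst_mul, hfst, mul_zero, fst_zero]
    · simp [hfst, -fst_mul]

lemma eq_zero_of_fst_eq_zero {u : 𝓓} (hu : u * u = u) (h : u.fst = 0) : u = 0 := by
  rw [← hu]
  ext1 <;> simp [h]

lemma exists_mul_mul_eq_inl_single {u : 𝓓} {x : X} (h : u.fst x x ≠ 0) :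
    ∃ a b : 𝓓, a * u * b = inl (single K x) := by
  refine ⟨inl ((u.fst x x)⁻¹ • single K x) -
    inr (((u.fst x x)⁻¹ ^ 2 * u.snd x x) • single K x), inl (single K x), ?_⟩
  ext1
  · simp [single_mul_mul_single, smul_smul, h]
  · have hc : (u.fst x x ^ 2)⁻¹ * u.snd x x * u.fst x x = (u.fst x x)⁻¹ * u.snd x x := by
      field_simp
    simp [single_mul_mul_single, smul_smul, hc]

lemma inl_single_mul_mul_inl_single_eq_zero {x y : X} (h : ¬x ≤ y) (u : 𝓓) :
    inl (single K x) * u * inl (single K y) = 0 := by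
  ext1 <;> simp [single_mul_mul_single_eq_zero h]

lemma inl_single_mul_zeta_mul_inl_single_ne_zero [DecidableLE X] {x y : X} (h : x ≤ y) :
    (inl (single K x) * inl (zeta K) * inl (single K y) : 𝓓) ≠ 0 := by
  intro h0
  have := congrArg (fun v : 𝓓 ↦ v.fst x y) h0
  simp [mul_single_apply, single_mul_apply, h, -mul_apply] at this

/-- An involutive anti-automorphism of the idealization induces an involutive anti-automorphism
of the poset. -/
theorem exists_involution_of_idealization {Φ : 𝓓 → 𝓓} (hadd : ∀ u v, Φ (u + v) = Φ u + Φ v)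
    (hmul : ∀ u v, Φ (u * v) = Φ v * Φ u) (hinv : ∀ u, Φ (Φ u) = u) :
    ∃ μ : X → X, Function.Bijective μ ∧ (∀ x y : X, x ≤ y ↔ μ y ≤ μ x) ∧
      ∀ x : X, μ (μ x) = x := by
  classical
  have hinj : Function.Injective Φ := (show Function.Involutive Φ from hinv).injective
  have hzero : Φ 0 = 0 := by simpa using hadd 0 0
  have hne : ∀ {u}, u ≠ 0 → Φ u ≠ 0 := fun hu h ↦ hu (hinj (h.trans hzero.symm))
  have hpow : ∀ u n, n ≠ 0 → Φ (u ^ n) = Φ u ^ n := by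
    intro u n hn
    induction n, Nat.one_le_iff_ne_zero.2 hn using Nat.le_induction with
    | base => simp
    | succ n hn ih => rw [pow_succ, hmul, ih (by lia), pow_succ']
  have hnil : ∀ u, IsNilpotent u → IsNilpotent (Φ u) := by
    rintro u ⟨n, hn⟩
    refine ⟨n + 1, ?_⟩
    rw [← hpow _ _ n.succ_ne_zero, pow_succ, hn, zero_mul, hzero]
  have hsymm : ∀ x y, (Φ (inl (single K x))).fst y y ≠ 0 →
      (Φ (inl (single K y))).fst x x ≠ 0 := by
    intro x y hxy h
    rw [← isNilpotent_inl_single_mul_iff] at h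
    apply hxy
    rw [← isNilpotent_inl_single_mul_iff]
    have := hnil _ h
    rwa [hmul, hinv] at this
  have hidem : ∀ x, (inl (single K x) * inl (single K x) : 𝓓) = inl (single K x) := fun x ↦ by
    rw [inl_mul_inl, single_mul_self]
  have hex : ∀ x, ∃ y, (Φ (inl (single K x))).fst y y ≠ 0 := by
    intro x
    by_contra! hd
    have hΦ : Φ (inl (single K x)) * Φ (inl (single K x)) = Φ (inl (single K x)) := by
      rw [← hmul, hidem]
    refine hne ?_ (eq_zero_of_fst_eq_zero hΦ
      (eq_zero_of_mul_self_of_diag (by rw [← fst_mul, hΦ]) hd))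
    intro h
    simpa [single_apply] using congrArg (fun v : 𝓓 ↦ v.fst x x) h
  have huniq : ∀ x x' y, (Φ (inl (single K x))).fst y y ≠ 0 →
      (Φ (inl (single K x'))).fst y y ≠ 0 → x = x' := by
    intro x x' y h h'
    by_contra hxx
    have h0 : Φ (inl (single K x')) * Φ (inl (single K x)) = 0 := by
      rw [← hmul, inl_mul_inl, single_mul_single_of_ne hxx, inl_zero, hzero]
    have := congrArg (fun v : 𝓓 ↦ v.fst y y) h0
    simp only [fst_mul, mul_apply_self, fst_zero, zero_apply] at this
    exact mul_ne_zero h' h this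
  choose μ hμ using hex
  have hμμ : ∀ x, μ (μ x) = x := fun x ↦ huniq _ _ _ (hsymm _ _ (hμ (μ x))) (hμ x)
  have hgen : ∀ x, ∃ a b, a * inl (single K (μ x)) * b = Φ (inl (single K x)) := by
    intro x
    obtain ⟨a, b, hab⟩ := exists_mul_mul_eq_inl_single (hsymm _ _ (hμ x))
    exact ⟨Φ b, Φ a, by rw [← hab, hmul, hmul, hinv, mul_assoc]⟩
  have hle : ∀ x y, x ≤ y → μ y ≤ μ x := by
    intro x y hxy
    by_contra hnle
    refine hne (inl_single_mul_zeta_mul_inl_single_ne_zero (K := K) hxy) ?_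
    obtain ⟨a, b, hab⟩ := hgen x
    obtain ⟨c, d, hcd⟩ := hgen y
    rw [hmul, hmul, ← hab, ← hcd]
    have := inl_single_mul_mul_inl_single_eq_zero hnle (d * Φ (inl (zeta K)) * a)
    calc
      _ = c * (inl (single K (μ y)) * (d * Φ (inl (zeta K)) * a) * inl (single K (μ x))) * b := by
        simp only [mul_assoc]
      _ = 0 := by rw [this, mul_zero, zero_mul]
  refine ⟨μ, (show Function.Involutive μ from hμμ).bijective, fun x y ↦ ⟨hle x y, fun h ↦ ?_⟩, hμμ⟩
  simpa only [hμμ] using hle _ _ h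

end Idealization

/-- Pull back an element of the incidence algebra along an antitone map, exchanging arguments. -/
def flip {μ : X → X} (hμ : ∀ x y : X, x ≤ y ↔ μ y ≤ μ x) (f : IncidenceAlgebra K X) :
    IncidenceAlgebra K X :=
  ⟨fun a b ↦ f (μ b) (μ a), fun a b h ↦ apply_eq_zero_of_not_le (mt (hμ a b).2 h) f⟩

section Flip

variable {μ : X → X} (hμ : ∀ x y : X, x ≤ y ↔ μ y ≤ μ x)

lemma flip_apply (f : IncidenceAlgebra K X) (a b : X) : flip hμ f a b = f (μ b) (μ a) := rfl

lemma flip_add (f g : IncidenceAlgebra K X) : flip hμ (f + g) = flip hμ f + flip hμ g := rfl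

lemma flip_flip (hinv : ∀ x, μ (μ x) = x) (f : IncidenceAlgebra K X) :
    flip hμ (flip hμ f) = f := by
  ext a b _
  simp only [flip_apply, hinv]

lemma flip_mul [LocallyFiniteOrder X] (hinv : ∀ x, μ (μ x) = x) (f g : IncidenceAlgebra K X) :
    flip hμ (f * g) = flip hμ g * flip hμ f := by
  ext a b _
  simp only [flip_apply, mul_apply]
  refine Finset.sum_nbij' μ μ ?_ ?_ (fun x _ ↦ hinv x) (fun x _ ↦ hinv x) ?_
  · intro x hx
    rw [Finset.mem_Icc] at hx ⊢
    rw [hμ a, hμ _ b, hinv]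
    exact hx.symm
  · intro x hx
    rw [Finset.mem_Icc] at hx ⊢
    rw [← hμ, ← hμ]
    exact hx.symm
  · intro x _
    rw [hinv, mul_comm]

end Flip

end IncidenceAlgebra

/-- Let `K` be a field and `X` a locally finite poset.  There is an involution on the
`K`-algebra `D(X,K) = I(X,K)(+)I(X,K)` (a `K`-linear bijection reversing products and of
order two) if and only if there is an involution on the poset `X` (an order
anti-automorphism of order two). -/
theorem exists_involution_D_iff_exists_involution
    (K X : Type*) [Field K] [PartialOrder X] [LocallyFiniteOrder X] [DecidableEq X] :
    (∃ Φ : TrivSqZeroExt (IncidenceAlgebra K X) (IncidenceAlgebra K X) →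
           TrivSqZeroExt (IncidenceAlgebra K X) (IncidenceAlgebra K X),
        Function.Bijective Φ ∧
        (∀ u v, Φ (u + v) = Φ u + Φ v) ∧
        (∀ (k : K) u, Φ (k • u) = k • Φ u) ∧
        (∀ u v, Φ (u * v) = Φ v * Φ u) ∧
        (∀ u, Φ (Φ u) = u)) ↔
      (∃ μ : X → X, Function.Bijective μ ∧ (∀ x y : X, x ≤ y ↔ μ y ≤ μ x) ∧
        ∀ x : X, μ (μ x) = x) := by
  constructor
  · rintro ⟨Φ, -, hadd, -, hmul, hinv⟩
    exact IncidenceAlgebra.exists_involution_of_idealization hadd hmul hinv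
  · rintro ⟨μ, -, hμ, hinv⟩
    have hΦ : Function.Involutive
        (fun u : TrivSqZeroExt (IncidenceAlgebra K X) (IncidenceAlgebra K X) ↦
          ((u.fst.flip hμ, u.snd.flip hμ) :
            TrivSqZeroExt (IncidenceAlgebra K X) (IncidenceAlgebra K X))) := fun u ↦
      TrivSqZeroExt.ext (IncidenceAlgebra.flip_flip hμ hinv _)
        (IncidenceAlgebra.flip_flip hμ hinv _)
    refine ⟨_, hΦ.bijective, fun u v ↦ rfl, fun k u ↦ rfl, fun u v ↦ ?_, hΦ⟩
    refine TrivSqZeroExt.ext (IncidenceAlgebra.flip_mul hμ hinv _ _) ?_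
    change IncidenceAlgebra.flip hμ (u.fst * v.snd + u.snd * v.fst) =
      v.fst.flip hμ * u.snd.flip hμ + v.snd.flip hμ * u.fst.flip hμ
    rw [IncidenceAlgebra.flip_add, IncidenceAlgebra.flip_mul hμ hinv,
      IncidenceAlgebra.flip_mul hμ hinv, add_comm]
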